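/- For every sparse environment (i.e., for every choice of λ_k ∈ (0,1) and positive integers d_k, k ∈ ℤ), the following two identities hold as equalities in [0, +∞]: (a) Σ_{k=1}^∞ ∏_{j=1}^{k} ρ_j = (a_1 − 1) + Σ_{n=1}^∞ (∏_{j=1}^{n} ξ_j)·d_{n+1}; (b) Σ_{k=0}^∞ ∏_{j=0}^{k} ρ_{−j}^{−1} = Σ_{n=0}^∞ (∏_{j=0}^{n} ξ_{−j}^{−1})·d_{−n}. -/

import Mathlib

open MeasureTheory ProbabilityTheory Filter Set
open scoped ENNReal NNReal Topology

noncomputable section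

/-- One-step transition probability of the nearest-neighbour walk in environment `env`:
probability `env i` of a step from `i` to `i+1`, probability `1 - env i` of a step
from `i` to `i-1`. -/
def stepProb (env : ℤ → ℝ) (i j : ℤ) : ℝ :=
  if j = i + 1 then env i else if j = i - 1 then 1 - env i else 0

/-- `IsQuenchedRW env x μ` says that `μ` is the quenched law `P_{x,ω}` of the random walk
in the environment `env` started at `x`: a probability measure on trajectories whose
cylinder probabilities are products of the one-step transition probabilities. -/
def IsQuenchedRW (env : ℤ → ℝ) (x : ℤ) (μ : Measure (ℕ → ℤ)) : Prop :=
  IsProbabilityMeasure μ ∧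
  ∀ (n : ℕ) (path : ℕ → ℤ), path 0 = x →
    μ {f | ∀ k ≤ n, f k = path k}
      = ENNReal.ofReal (∏ k ∈ Finset.range n, stepProb env (path k) (path (k + 1)))

/-- The sparse environment: `lam k` at the marked site `a k`, and `1/2` elsewhere. -/
def sparseEnv (lam : ℤ → ℝ) (a : ℤ → ℤ) (n : ℤ) : ℝ :=
  haveI := Classical.propDecidable (∃ k, a k = n)
  if h : ∃ k, a k = n then lam h.choose else 1 / 2

theorem aux_blocks (f g : ℕ → ℝ≥0∞) (b : ℕ → ℕ) (hb : StrictMono b) (hb0 : b 0 = 0)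
    (hfb : ∀ n, f (b n) = g n) (hf1 : ∀ m, (∀ n, b n ≠ m) → f m = 1) :
    ∑' k : ℕ, ∏ j ∈ Finset.range (k + 1), f j
      = ∑' n : ℕ, (∏ j ∈ Finset.range (n + 1), g j) * ((b (n + 1) - b n : ℕ) : ℝ≥0∞) := by
  have step : ∀ n, (∏ j ∈ Finset.range (b n), f j = ∏ j ∈ Finset.range n, g j) →
      ∀ m, b n + m < b (n + 1) →
        ∏ j ∈ Finset.range (b n + m + 1), f j = ∏ j ∈ Finset.range (n + 1), g j := by
    intro n hn m
    induction m with
    | zero =>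
      intro _
      rw [add_zero, Finset.prod_range_succ, hn, hfb, Finset.prod_range_succ]
    | succ m ih =>
      intro h
      rw [Finset.prod_range_succ, ← add_assoc, ih (by omega), hf1, mul_one]
      intro k hk
      have h1 : n < k := hb.lt_iff_lt.1 (by omega)
      have h2 : k < n + 1 := hb.lt_iff_lt.1 (by omega)
      omega
  have base : ∀ n, ∏ j ∈ Finset.range (b n), f j = ∏ j ∈ Finset.range n, g j := by
    intro n
    induction n with
    | zero => simp [hb0]
    | succ n ih =>
      have h := hb (Nat.lt_add_one n)
      have := step n ih (b (n + 1) - b n - 1) (by omega)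
      rw [← this]
      congr 2
      omega
  have part : ∀ N, ∑ k ∈ Finset.range (b N), ∏ j ∈ Finset.range (k + 1), f j
      = ∑ n ∈ Finset.range N,
        (∏ j ∈ Finset.range (n + 1), g j) * ((b (n + 1) - b n : ℕ) : ℝ≥0∞) := by
    intro N
    induction N with
    | zero => simp [hb0]
    | succ N ih =>
      have h := hb (Nat.lt_add_one N)
      have e : b (N + 1) = b N + (b (N + 1) - b N) := by omega
      rw [Finset.sum_range_succ, ← ih]
      conv_lhs => rw [e, Finset.sum_range_add]
      congr 1
      rw [Finset.sum_congr rfl (fun m hm => step N (base N) m (by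
        have := Finset.mem_range.1 hm
        omega))]
      simp [mul_comm]
  have t1 := (ENNReal.tendsto_nat_tsum (fun k => ∏ j ∈ Finset.range (k + 1), f j)).comp
    hb.tendsto_atTop
  have t2 := ENNReal.tendsto_nat_tsum (fun n => (∏ j ∈ Finset.range (n + 1), g j) *
    ((b (n + 1) - b n : ℕ) : ℝ≥0∞))
  refine tendsto_nhds_unique t1 (t2.congr fun N => (part N).symm)

theorem sparseEnv_at (lam : ℤ → ℝ) (a : ℤ → ℤ) (ha : StrictMono a) (k : ℤ) :
    sparseEnv lam a (a k) = lam k := by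
  have h : ∃ k', a k' = a k := ⟨k, rfl⟩
  unfold sparseEnv
  rw [dif_pos h, ha.injective h.choose_spec]

theorem sparseEnv_off (lam : ℤ → ℝ) (a : ℤ → ℤ) (n : ℤ) (h : ∀ k, a k ≠ n) :
    sparseEnv lam a n = 1 / 2 := by
  unfold sparseEnv
  rw [dif_neg (by simpa using h)]

theorem aux_prod (f : ℕ → ℝ≥0∞) (n : ℕ) :
    ∏ j ∈ Finset.range (n + 2), (if j = 0 then 1 else f j) = ∏ j ∈ Finset.Icc 1 (n + 1), f j := by
  rw [Finset.prod_range_succ', Finset.range_eq_Ico,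
    Finset.prod_Ico_add' (fun j => if j = 0 then 1 else f j) 0 (n + 1) 1]
  simp only [if_true, mul_one]
  refine Finset.prod_congr (by ext; simp) fun j hj => ?_
  have := (Finset.mem_Icc.1 hj).1
  rw [if_neg (by omega)]

/-- identities \eqref{curious} and \eqref{curious1}: for every sparse
environment, writing `ρ_n = (1-ω_n)/ω_n` and `ξ_n = (1-λ_n)/λ_n`,
(a) `Σ_{k=1}^∞ ∏_{j=1}^k ρ_j = (a_1 - 1) + Σ_{n=1}^∞ (∏_{j=1}^n ξ_j)·d_{n+1}` and
(b) `Σ_{k=0}^∞ ∏_{j=0}^k ρ_{-j}⁻¹ = Σ_{n=0}^∞ (∏_{j=0}^n ξ_{-j}⁻¹)·d_{-n}`,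
as identities in `[0,∞]`. -/
theorem statement16
    (lam : ℤ → ℝ) (d : ℤ → ℕ) (a : ℤ → ℤ)
    (hlam01 : ∀ k, lam k ∈ Set.Ioo (0 : ℝ) 1)
    (hd_pos : ∀ k, 1 ≤ d k)
    (ha0 : a 0 = 0)
    (ha_rec : ∀ k : ℤ, a k - a (k - 1) = d k) :
    -- (a)
    (∑' k : ℕ, ∏ j ∈ Finset.Icc 1 (k + 1),
        ENNReal.ofReal ((1 - sparseEnv lam a (j : ℤ)) / sparseEnv lam a (j : ℤ))
      = ENNReal.ofReal ((a 1 : ℝ) - 1)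
        + ∑' n : ℕ, (∏ j ∈ Finset.Icc 1 (n + 1),
            ENNReal.ofReal ((1 - lam (j : ℤ)) / lam (j : ℤ)))
          * (d ((n : ℤ) + 2) : ℝ≥0∞)) ∧
    -- (b)
    (∑' k : ℕ, ∏ j ∈ Finset.range (k + 1),
        ENNReal.ofReal (((1 - sparseEnv lam a (-(j : ℤ))) / sparseEnv lam a (-(j : ℤ)))⁻¹)
      = ∑' n : ℕ, (∏ j ∈ Finset.range (n + 1),
            ENNReal.ofReal (((1 - lam (-(j : ℤ))) / lam (-(j : ℤ)))⁻¹))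
          * (d (-(n : ℤ)) : ℝ≥0∞)) := by
  have ha : StrictMono a := by
    refine strictMono_int_of_lt_succ fun k => ?_
    have h1 := ha_rec (k + 1)
    have h2 := hd_pos (k + 1)
    rw [add_sub_cancel_right] at h1
    omega
  constructor
  · have hnn : ∀ n : ℕ, 0 ≤ a n := fun n => by
      rw [← ha0]; exact ha.monotone (by omega)
    have hcast : ∀ n : ℕ, (((a n).toNat : ℕ) : ℤ) = a n := fun n => Int.toNat_of_nonneg (hnn n)
    have key := aux_blocks
      (fun j => if j = 0 then 1 else
        ENNReal.ofReal ((1 - sparseEnv lam a (j : ℤ)) / sparseEnv lam a (j : ℤ)))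
      (fun j => if j = 0 then 1 else ENNReal.ofReal ((1 - lam (j : ℤ)) / lam (j : ℤ)))
      (fun n => (a n).toNat)
      (by
        intro m n hmn
        have h1 : a m < a n := ha (by omega)
        have h2 := hcast m
        have h3 := hcast n
        show (a m).toNat < (a n).toNat
        omega)
      (by simp [ha0])
      (by
        intro n
        have h2 := hcast n
        by_cases hn : n = 0
        · simp [hn, ha0]
        · have h1 : a 0 < a n := ha (by omega)
          have h3 : (a n).toNat ≠ 0 := by omega
          simp only [if_neg h3, if_neg hn, h2, sparseEnv_at lam a ha])
      (by
        intro m hm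
        by_cases h0 : m = 0
        · simp [h0]
        · simp only [if_neg h0]
          rw [sparseEnv_off]
          · norm_num
          · intro k hk
            have : 0 < k := ha.lt_iff_lt.1 (by omega)
            lift k to ℕ using this.le
            exact hm k (by show (a k).toNat = m; omega))
    have key := (tsum_eq_zero_add' ENNReal.summable).symm.trans
      (key.trans (tsum_eq_zero_add' ENNReal.summable))
    simp only [add_assoc, Nat.reduceAdd, aux_prod] at key
    have hd : ∀ n : ℕ, (a ((n + 2 : ℕ) : ℤ)).toNat - (a ((n + 1 : ℕ) : ℤ)).toNat
        = d ((n : ℤ) + 2) := by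
      intro n
      have h1 := hcast (n + 2)
      have h2 := hcast (n + 1)
      have h3 := ha_rec ((n : ℤ) + 2)
      have e : (n : ℤ) + 2 - 1 = ((n + 1 : ℕ) : ℤ) := by push_cast; ring
      have e' : (n : ℤ) + 2 = ((n + 2 : ℕ) : ℤ) := by push_cast; ring
      rw [e, e'] at h3
      rw [e']
      omega
    simp only [hd] at key
    have h1 : a 0 < a 1 := ha (by omega)
    have h2 : (((a 1).toNat : ℕ) : ℝ≥0∞) = 1 + ENNReal.ofReal ((a 1 : ℝ) - 1) := by
      have h3 : (1 : ℝ) ≤ a 1 := by exact_mod_cast (by omega : (1 : ℤ) ≤ a 1)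
      rw [← ENNReal.ofReal_one, ← ENNReal.ofReal_add (by norm_num) (by linarith),
        ← ENNReal.ofReal_natCast]
      congr 1
      have h4 : (((a 1).toNat : ℕ) : ℤ) = a 1 := by omega
      have h5 : (((a 1).toNat : ℕ) : ℝ) = a 1 := by exact_mod_cast h4
      rw [h5]; ring
    simp only [zero_add, Finset.prod_range_one, if_true, one_mul, Nat.cast_zero, Nat.cast_one,
      ha0, Int.toNat_zero, Nat.sub_zero, h2, add_assoc] at key
    exact (ENNReal.add_right_inj ENNReal.one_ne_top).1 key
  · have hnn : ∀ n : ℕ, a (-n) ≤ 0 := fun n => by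
      rw [← ha0]; exact ha.monotone (by omega)
    have hcast : ∀ n : ℕ, (((-a (-n)).toNat : ℕ) : ℤ) = -a (-n) := fun n =>
      Int.toNat_of_nonneg (by have := hnn n; omega)
    have key := aux_blocks
      (fun j => ENNReal.ofReal
        (((1 - sparseEnv lam a (-(j : ℤ))) / sparseEnv lam a (-(j : ℤ)))⁻¹))
      (fun j => ENNReal.ofReal (((1 - lam (-(j : ℤ))) / lam (-(j : ℤ)))⁻¹))
      (fun n => (-a (-n)).toNat)
      (by
        intro m n hmn
        have h1 : a (-n) < a (-m) := ha (by omega)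
        have h2 := hcast m
        have h3 := hcast n
        show (-a (-m)).toNat < (-a (-n)).toNat
        omega)
      (by simp [ha0])
      (by
        intro n
        simp only [hcast n, neg_neg, sparseEnv_at lam a ha])
      (by
        intro m hm
        rw [sparseEnv_off]
        · norm_num
        · intro k hk
          have : k ≤ 0 := ha.le_iff_le.1 (by omega)
          obtain ⟨n, rfl⟩ : ∃ n : ℕ, k = -(n : ℤ) := ⟨(-k).toNat, by omega⟩
          exact hm n (by show (-a (-n)).toNat = m; omega))
    rw [key]
    refine tsum_congr fun n => ?_
    congr 2
    have h1 := hcast n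
    have h2 := hcast (n + 1)
    have h3 := ha_rec (-(n : ℤ))
    have e : -(n : ℤ) - 1 = -((n + 1 : ℕ) : ℤ) := by push_cast; ring
    rw [e] at h3
    omega
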